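/- arXiv:1507.04319 — 2 statements merged into one kernel-verified Lean document; each statement's English description precedes it below -/
import Mathlib

section
/- For all positive integers n and k with 1 ≤ k ≤ 2^n, the cardinality of the class C_{n,k} satisfies |C_{n,k}| ≤ binomial(2^{n+1}, k)². -/
/-- The Boolean cube `{±1}^n`, as a subtype of `Fin n → ℝ`. -/
abbrev Cube (n : ℕ) := {x : Fin n → ℝ // ∀ j, x j = 1 ∨ x j = -1}

/-- The class `C_{n,k}` of `{±1}`-valued functions on the Boolean cube that are signs of
`k`-sparse polynomials (in the Fourier/monomial basis). -/
def Cclass (n k : ℕ) : Set (Cube n → ℝ) :=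
  {g | (∀ x, g x = 1 ∨ g x = -1) ∧
    ∃ (S : Fin k → Finset (Fin n)) (a : Fin k → ℝ),
      ∀ x : Cube n, 0 < g x * ∑ i, a i * ∏ j ∈ S i, x.1 j}

/-- The sets on which some linear combination of the functions `φ i`, `i ∈ I`, is positive,
among the combinations that vanish nowhere. -/
noncomputable def positivitySets {ι X : Type*} [Fintype X] (I : Finset ι) (φ : ι → X → ℝ) :
    Finset (Finset X) :=
  open Classical in
  {A | ∃ a : ι → ℝ, ∀ x, (x ∈ A → 0 < ∑ i ∈ I, a i * φ i x) ∧
    (x ∉ A → ∑ i ∈ I, a i * φ i x < 0)}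

/-- A family of sign patterns of a space spanned by `#I` functions has VC dimension at most `#I`:
on a larger set of points the evaluations are linearly dependent, and no function in the span can
have the same sign as the coefficients of a dependency. -/
theorem card_le_of_shatters_positivitySets {ι X : Type*} [Fintype X] [DecidableEq X]
    {I : Finset ι} {φ : ι → X → ℝ} {T : Finset X} (hT : (positivitySets I φ).Shatters T) :
    T.card ≤ I.card := by
  classical
  by_contra! hlt
  have hdep : ¬ LinearIndependent ℝ (fun (x : T) (i : I) => φ i x) := fun h => by
    have := h.fintype_card_le_finrank
    simp at this
    omega
  obtain ⟨c, hc, ⟨y, hy⟩⟩ := Fintype.not_linearIndependent_iff.1 hdep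
  obtain ⟨A, hA, hTA⟩ := hT (t := {x ∈ T | ∃ h : x ∈ T, 0 < c ⟨x, h⟩}) (Finset.filter_subset _ _)
  simp only [positivitySets, Finset.mem_filter, Finset.mem_univ, true_and] at hA
  obtain ⟨a, ha⟩ := hA
  have hmem (x : T) : (x : X) ∈ A ↔ 0 < c x := by
    have := Finset.ext_iff.1 hTA x
    simpa using this
  have hpos (x : T) (hx : c x ≠ 0) : 0 < c x * ∑ i ∈ I, a i * φ i x := by
    by_cases h : (x : X) ∈ A
    · exact mul_pos ((hmem x).1 h) ((ha x).1 h)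
    · exact mul_pos_of_neg_of_neg (lt_of_le_of_ne (not_lt.1 (mt (hmem x).2 h)) hx) ((ha x).2 h)
  have hzero : ∑ x : T, c x * ∑ i ∈ I, a i * φ i x = 0 := by
    simp_rw [Finset.mul_sum]
    rw [Finset.sum_comm]
    refine Finset.sum_eq_zero fun i hi => ?_
    have h := congrFun hc ⟨i, hi⟩
    simp only [Finset.sum_apply, Pi.smul_apply, smul_eq_mul, Pi.zero_apply] at h
    calc ∑ x : T, c x * (a i * φ i x) = a i * ∑ x : T, c x * φ i x := by
          rw [Finset.mul_sum]
          exact Finset.sum_congr rfl fun x _ => by ring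
      _ = 0 := by rw [h, mul_zero]
  refine hzero.not_gt (Finset.sum_pos' (fun x _ => ?_) ⟨y, Finset.mem_univ _, hpos y hy⟩)
  by_cases hx : c x = 0
  · simp [hx]
  · exact (hpos x hx).le

theorem card_positivitySets_le {ι X : Type*} [Fintype X] (I : Finset ι) (φ : ι → X → ℝ) :
    (positivitySets I φ).card ≤ ∑ i ∈ Finset.Iic I.card, (Fintype.card X).choose i := by
  classical
  refine (Finset.card_le_card_shatterer _).trans (Finset.card_shatterer_le_sum_vcDim.trans ?_)
  refine Finset.sum_le_sum_of_subset (Finset.Iic_subset_Iic.2 ?_)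
  exact Finset.sup_le fun T hT =>
    card_le_of_shatters_positivitySets (Finset.mem_shatterer.1 hT)

theorem sum_choose_le_choose_two_mul {N k : ℕ} (hk : k ≤ N) :
    ∑ i ∈ Finset.Iic k, N.choose i ≤ (2 * N).choose k := by
  rw [two_mul, Nat.add_choose_eq, Finset.Nat.sum_antidiagonal_eq_sum_range_succ
    (fun i j => N.choose i * N.choose j), ← Nat.range_succ_eq_Iic]
  exact Finset.sum_le_sum fun i _ =>
    Nat.le_mul_of_pos_right _ (Nat.choose_pos ((Nat.sub_le k i).trans hk))

theorem nonempty_cube_equiv (n : ℕ) : Nonempty (Cube n ≃ (Fin n → Bool)) := by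
  classical
  refine ⟨⟨fun x j => decide (x.1 j = 1), fun b => ⟨fun j => if b j then 1 else -1, fun j => ?_⟩,
    fun x => ?_, fun b => ?_⟩⟩
  · exact ite_eq_or_eq _ _ _
  · ext j
    rcases x.2 j with h | h <;> norm_num [h]
  · ext j
    cases h : b j <;> norm_num [h]

/-- The `±1`-valued function that is `1` exactly on `A`. -/
noncomputable def signIndicator {X : Type*} (A : Finset X) (x : X) : ℝ :=
  open Classical in if x ∈ A then 1 else -1

/-- Each function in `Cclass n k` is the sign of a combination of exactly `k` distinct monomials. -/
theorem exists_eq_signIndicator_of_mem_Cclass {n k : ℕ} [Fintype (Cube n)] (hk : k ≤ 2 ^ n)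
    {g : Cube n → ℝ} (hg : g ∈ Cclass n k) :
    ∃ I ∈ Finset.powersetCard k (Finset.univ : Finset (Finset (Fin n))),
      ∃ A ∈ positivitySets I (fun S (x : Cube n) => ∏ j ∈ S, x.1 j), signIndicator A = g := by
  classical
  obtain ⟨hg1, S, a, hS⟩ := hg
  obtain ⟨I, hSI, hI⟩ := Finset.exists_superset_card_eq (s := Finset.univ.image S) (n := k)
    (Finset.card_image_le.trans (by simp)) (by simpa using hk)
  refine ⟨I, by simp [Finset.mem_powersetCard, hI], Finset.univ.filter (g · = 1), ?_, ?_⟩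
  · simp only [positivitySets, Finset.mem_filter, Finset.mem_univ, true_and]
    refine ⟨fun T => ∑ i with S i = T, a i, fun x => ?_⟩
    have hsum : ∑ T ∈ I, (∑ i with S i = T, a i) * ∏ j ∈ T, x.1 j =
        ∑ i, a i * ∏ j ∈ S i, x.1 j := by
      rw [← Finset.sum_fiberwise_of_maps_to (t := I) (g := S)
        fun i _ => hSI (Finset.mem_image_of_mem S (Finset.mem_univ i))]
      refine Finset.sum_congr rfl fun T _ => ?_
      rw [Finset.sum_mul]
      exact Finset.sum_congr rfl fun i hi => by rw [(Finset.mem_filter.1 hi).2]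
    rw [hsum]
    have hx := hS x
    refine ⟨fun h => ?_, fun h => ?_⟩
    · rwa [h, one_mul] at hx
    · rw [(hg1 x).resolve_left h] at hx
      linarith
  · funext x
    rcases hg1 x with h | h <;> norm_num [signIndicator, h]

/-- The cardinality of `C_{n,k}` is at most `binomial (2^(n+1)) k ^ 2`. -/
theorem card_Cclass_le (n k : ℕ) (hn : 0 < n) (hk : 1 ≤ k) (hk' : k ≤ 2 ^ n) :
    (Cclass n k).ncard ≤ Nat.choose (2 ^ (n + 1)) k ^ 2 := by
  classical
  obtain ⟨e⟩ := nonempty_cube_equiv n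
  let := Fintype.ofEquiv _ e.symm
  have hcard : Fintype.card (Cube n) = 2 ^ n := by simp [Fintype.card_congr e]
  let F : Finset (Cube n → ℝ) := (Finset.powersetCard k Finset.univ).biUnion fun I =>
    (positivitySets I fun S (x : Cube n) => ∏ j ∈ S, x.1 j).image signIndicator
  have hsub : Cclass n k ⊆ F := fun g hg => by
    obtain ⟨I, hI, A, hA, rfl⟩ := exists_eq_signIndicator_of_mem_Cclass hk' hg
    exact Finset.mem_biUnion.2 ⟨I, hI, Finset.mem_image_of_mem _ hA⟩
  have hF : F.card ≤ Nat.choose (2 ^ n) k * Nat.choose (2 ^ (n + 1)) k := by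
    refine (Finset.card_biUnion_le_card_mul _ _ (Nat.choose (2 ^ (n + 1)) k) fun I hI => ?_).trans
      (by simp)
    refine Finset.card_image_le.trans ((card_positivitySets_le _ _).trans ?_)
    rw [hcard, (Finset.mem_powersetCard.1 hI).2, pow_succ']
    exact sum_choose_le_choose_two_mul hk'
  calc (Cclass n k).ncard ≤ (F : Set (Cube n → ℝ)).ncard := Set.ncard_le_ncard hsub F.finite_toSet
    _ = F.card := Set.ncard_coe_finset F
    _ ≤ Nat.choose (2 ^ n) k * Nat.choose (2 ^ (n + 1)) k := hF
    _ ≤ Nat.choose (2 ^ (n + 1)) k ^ 2 := by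
      rw [sq]
      exact Nat.mul_le_mul_right _ (Nat.choose_le_choose k (Nat.pow_le_pow_right two_pos n.le_succ))
end

section
/- For all positive integers n and k with 1 ≤ k ≤ 2^n, the VC dimension of the class C_{n,k} is at least max{n, k}. -/
/-- A class of `{±1}`-valued functions shatters a finite set `T` if every `{±1}` labeling of
`T` is realized by a member of the class. -/
def Shatters {X : Type*} (C : Set (X → ℝ)) (T : Finset X) : Prop :=
  ∀ y : X → ℝ, (∀ t ∈ T, y t = 1 ∨ y t = -1) → ∃ g ∈ C, ∀ t ∈ T, g t = y t

/-- The cube point whose coordinates equal to `-1` are exactly those indexed by `A`. -/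
noncomputable def cubePoint {n : ℕ} (A : Finset (Fin n)) : Cube n :=
  ⟨fun j => if j ∈ A then -1 else 1, fun j => by by_cases h : j ∈ A <;> simp [h]⟩

theorem cubePoint_injective {n : ℕ} : Function.Injective (cubePoint (n := n)) := by
  intro A B h
  ext j
  have hj := congrFun (congrArg Subtype.val h) j
  by_cases hA : j ∈ A <;> by_cases hB : j ∈ B <;> simp [cubePoint, hA, hB] at hj ⊢ <;> norm_num at hj

theorem cubePoint_surjective {n : ℕ} : Function.Surjective (cubePoint (n := n)) := by
  intro x
  refine ⟨Finset.univ.filter fun j => x.1 j = -1, Subtype.ext (funext fun j => ?_)⟩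
  rcases x.2 j with h | h
  · have : ¬ ((1 : ℝ) = -1) := by norm_num
    simp [cubePoint, h, this]
  · simp [cubePoint, h]

instance finite_cube (n : ℕ) : Finite (Cube n) :=
  Finite.of_surjective _ cubePoint_surjective

/-- The monomial `∏ j ∈ S, x j` as a function on the cube. -/
def cubeMonomial {n : ℕ} (S : Finset (Fin n)) (x : Cube n) : ℝ := ∏ j ∈ S, x.1 j

theorem cubeMonomial_eq_one_or {n : ℕ} (S : Finset (Fin n)) (x : Cube n) :
    cubeMonomial S x = 1 ∨ cubeMonomial S x = -1 := by
  refine Finset.prod_induction _ (fun r : ℝ => r = 1 ∨ r = -1) ?_ (Or.inl rfl) fun j _ => x.2 j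
  rintro a b (rfl | rfl) (rfl | rfl) <;> simp

theorem cubeMonomial_cubePoint_singleton {n : ℕ} (S : Finset (Fin n)) (i : Fin n) :
    cubeMonomial S (cubePoint {i}) = if i ∈ S then -1 else 1 := by
  simp [cubeMonomial, cubePoint, Finset.prod_ite_eq']

/-- Expansion of the indicator function of a cube point into monomials. -/
theorem sum_cubeMonomial_mul {n : ℕ} (t x : Cube n) :
    ∑ S, cubeMonomial S t * cubeMonomial S x = if x = t then 2 ^ n else 0 := by
  have h : ∑ S, cubeMonomial S t * cubeMonomial S x = ∏ j, (1 + t.1 j * x.1 j) := by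
    simp [Finset.prod_one_add, cubeMonomial, Finset.prod_mul_distrib]
  rw [h]
  split_ifs with hxt
  · subst hxt
    have : ∀ j, 1 + x.1 j * x.1 j = 2 := fun j => by
      rcases x.2 j with h | h <;> rw [h] <;> norm_num
    simp [this]
  · obtain ⟨j, hj⟩ : ∃ j, x.1 j ≠ t.1 j := by
      by_contra! hall
      exact hxt (Subtype.ext (funext hall))
    refine Finset.prod_eq_zero (Finset.mem_univ j) ?_
    rcases x.2 j with h | h <;> rcases t.2 j with h' | h' <;> simp_all

theorem span_cubeMonomial_restrict {n : ℕ} (T : Finset (Cube n)) :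
    Submodule.span ℝ (Set.range fun S : Finset (Fin n) => fun t : T => cubeMonomial S t) = ⊤ := by
  rw [eq_top_iff]
  rintro y -
  rw [Submodule.mem_span_range_iff_exists_fun]
  refine ⟨fun S => ∑ t : T, y t / 2 ^ n * cubeMonomial S t, funext fun x => ?_⟩
  simp only [Finset.sum_apply, Pi.smul_apply, smul_eq_mul, Finset.sum_mul]
  rw [Finset.sum_comm]
  simp_rw [mul_assoc, ← Finset.mul_sum, sum_cubeMonomial_mul]
  simp

theorem exists_monomials_interpolating {n k : ℕ} (T : Finset (Cube n)) (hT : T.card = k) :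
    ∃ S : Fin k → Finset (Fin n), ∀ y : Cube n → ℝ,
      ∃ a : Fin k → ℝ, ∀ t ∈ T, ∑ i, a i * cubeMonomial (S i) t = y t := by
  have hspan := span_cubeMonomial_restrict T
  have hrank : Module.finrank ℝ (Submodule.span ℝ
      (Set.range fun S : Finset (Fin n) => fun t : T => cubeMonomial S t)) = k := by
    rw [hspan, finrank_top]
    simpa using hT
  obtain ⟨f, hf, hfspan, -⟩ := Submodule.exists_fun_fin_finrank_span_eq ℝ
    (Set.range fun S : Finset (Fin n) => fun t : T => cubeMonomial S t)
  replace hfspan := hfspan.trans hspan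
  choose S hS using hf
  refine ⟨S ∘ finCongr hrank.symm, fun y => ?_⟩
  obtain ⟨c, hc⟩ := (Submodule.mem_span_range_iff_exists_fun ℝ).mp
    (by rw [hfspan]; trivial : (fun t : T => y t) ∈ Submodule.span ℝ (Set.range f))
  refine ⟨c ∘ finCongr hrank.symm, fun t ht => ?_⟩
  have hct := congrFun hc ⟨t, ht⟩
  simp only [← hS, Finset.sum_apply, Pi.smul_apply, smul_eq_mul] at hct
  rw [← hct]
  exact Equiv.sum_comp (finCongr hrank.symm) fun i => c i * cubeMonomial (S i) t

theorem shatters_Cclass_of_card_eq {n k : ℕ} (hk : 1 ≤ k) (T : Finset (Cube n))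
    (hT : T.card = k) : Shatters (Cclass n k) T := by
  obtain ⟨S, hS⟩ := exists_monomials_interpolating T hT
  intro y hy
  obtain ⟨a, ha⟩ := hS y
  let i₀ : Fin k := ⟨0, hk⟩
  set p : Cube n → ℝ := fun x => ∑ i, a i * cubeMonomial (S i) x with hp
  set χ := cubeMonomial (S i₀) with hχ
  obtain ⟨ε, ⟨hε0, hε1⟩, hε⟩ : ∃ ε ∈ Set.Ioo (0 : ℝ) 1, ε ∉ Set.range fun x => -p x / χ x :=
    (Set.Ioo_infinite zero_lt_one).exists_notMem_finite (Set.finite_range _)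
  have hne : ∀ x, p x + ε * χ x ≠ 0 := by
    intro x h0
    refine hε ⟨x, ?_⟩
    rcases cubeMonomial_eq_one_or (S i₀) x with h | h <;> rw [← hχ] at h <;> simp only [h] at h0 ⊢ <;>
      linarith
  refine ⟨fun x => SignType.sign (p x + ε * χ x), ⟨fun x => ?_, S, a + Pi.single i₀ ε, fun x => ?_⟩,
    fun t ht => ?_⟩
  · rcases (hne x).lt_or_gt with h | h <;> simp [h]
  · have : ∑ i, (a + Pi.single i₀ ε : Fin k → ℝ) i * ∏ j ∈ S i, x.1 j = p x + ε * χ x := by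
      simp [hp, hχ, cubeMonomial, add_mul, Finset.sum_add_distrib, Pi.single_apply]
    rw [this, sign_mul_self]
    exact abs_pos.mpr (hne x)
  · have hpt : p t = y t := ha t ht
    have hb : |ε * χ t| < 1 := by
      rcases cubeMonomial_eq_one_or (S i₀) t with h | h <;> rw [hχ, h] <;> simp [abs_of_pos hε0, hε1]
    rw [abs_lt] at hb
    rcases hy t ht with h | h
    · have : 0 < p t + ε * χ t := by linarith
      simp [this, h]
    · have : p t + ε * χ t < 0 := by linarith
      simp [this, h]

theorem shatters_Cclass_singletons (n k : ℕ) (hk : 1 ≤ k) :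
    Shatters (Cclass n k)
      (Finset.univ.map ⟨fun i : Fin n => cubePoint {i},
        cubePoint_injective.comp Finset.singleton_injective⟩) := by
  intro y hy
  set S : Finset (Fin n) := Finset.univ.filter fun i => y (cubePoint {i}) = -1 with hS
  refine ⟨cubeMonomial S, ⟨cubeMonomial_eq_one_or S, fun _ => S, Pi.single ⟨0, hk⟩ 1,
    fun x => ?_⟩, fun t ht => ?_⟩
  · have : ∑ i, (Pi.single ⟨0, hk⟩ 1 : Fin k → ℝ) i * ∏ j ∈ S, x.1 j = cubeMonomial S x := by
      simp [← Finset.sum_mul, cubeMonomial]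
    rw [this]
    rcases cubeMonomial_eq_one_or S x with h | h <;> simp [h]
  · have hyt := hy t ht
    obtain ⟨i, -, rfl⟩ := Finset.mem_map.mp ht
    simp only [Function.Embedding.coeFn_mk] at hyt ⊢
    rw [cubeMonomial_cubePoint_singleton]
    rcases hyt with h | h
    · have : ¬ ((1 : ℝ) = -1) := by norm_num
      simp [hS, h, this]
    · simp [hS, h]

/-- For `1 ≤ k ≤ 2^n`, the VC dimension of `C_{n,k}` is at least `max n k`. -/
theorem vcDim_Cclass_ge_max (n k : ℕ) (hn : 0 < n) (hk : 1 ≤ k) (hk' : k ≤ 2 ^ n) :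
    ∃ T : Finset (Cube n), T.card = max n k ∧ Shatters (Cclass n k) T := by
  rcases le_total k n with h | h
  · exact ⟨_, by simp [h], shatters_Cclass_singletons n k hk⟩
  · obtain ⟨U, -, hU⟩ := Finset.exists_subset_card_eq
      (s := (Finset.univ : Finset (Finset (Fin n)))) (n := k) (by simpa using hk')
    have hT : (U.map ⟨cubePoint, cubePoint_injective⟩).card = k := by simpa using hU
    exact ⟨_, by rw [hT, max_eq_right h], shatters_Cclass_of_card_eq hk _ hT⟩
end
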